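/- Let G be a simple graph with vertex set V. Then the map sending a smooth travel groupoid (V,*) on G to its right translation system is a bijection between the set of all smooth travel groupoids on G and the set of all smooth T-partition systems on G. -/

import Mathlib

variable {V : Type*}

/-- The right translation system of a groupoid `(V, op)`:
`rts op u v = {w ∈ V | u * w = v}`. -/
def rts (op : V → V → V) (u v : V) : Set V := {w | op u w = v}

/-- Axiom (t1): `(u * v) * u = u` for all `u, v`. -/
def T1 (op : V → V → V) : Prop := ∀ u v : V, op (op u v) u = u

/-- Axiom (t2): if `(u * v) * v = u` then `u = v`. -/
def T2 (op : V → V → V) : Prop := ∀ u v : V, op (op u v) v = u → u = v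

/-- A travel groupoid: a groupoid satisfying (t1) and (t2). -/
def IsTravelGroupoid (op : V → V → V) : Prop := T1 op ∧ T2 op

/-- Axiom (t3) (simple): if `v * u ≠ u` then `u * (v * u) = u * v`. -/
def T3 (op : V → V → V) : Prop := ∀ u v : V, op v u ≠ u → op u (op v u) = op u v

/-- Axiom (t4) (smooth): if `u * v = u * w` then `u * (v * w) = u * v`. -/
def T4 (op : V → V → V) : Prop := ∀ u v w : V, op u v = op u w → op u (op v w) = op u v

/-- Axiom (t5) (semi-smooth): if `u * v = u * w` then
`u * (v * w) = u * v` or `u * ((v * w) * w) = u * v`. -/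
def T5 (op : V → V → V) : Prop :=
  ∀ u v w : V, op u v = op u w →
    op u (op v w) = op u v ∨ op u (op (op v w) w) = op u v

/-- A travel groupoid `(V, op)` is on the graph `G` if the edges of `G` are exactly
the pairs `{u, v}` with `u ≠ v` and `u * v = v`. -/
def IsOnGraph (op : V → V → V) (G : SimpleGraph V) : Prop :=
  ∀ u v : V, G.Adj u v ↔ u ≠ v ∧ op u v = v

/-- The closed neighborhood `N_G[u]` of a vertex `u` in a graph `G`. -/
def closedNbhd (G : SimpleGraph V) (u : V) : Set V := insert u (G.neighborSet u)

/-- A T-partition system on a graph `G`: a family `P u v ⊆ V` indexed by pairs of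
vertices satisfying (P0) (stated as: the sets `P u v` for `v ∈ N_G[u]` cover `V`
and are pairwise disjoint), (P1a), (P1b), (P1c), and (P2). -/
structure IsTPartitionSystem (G : SimpleGraph V) (P : V → V → Set V) : Prop where
  cover : ∀ u a : V, ∃ v ∈ closedNbhd G u, a ∈ P u v
  pairwise_disjoint : ∀ u : V, ∀ v ∈ closedNbhd G u, ∀ w ∈ closedNbhd G u,
    v ≠ w → P u v ∩ P u w = ∅
  p1a : ∀ u : V, P u u = {u}
  p1b : ∀ u v : V, u ≠ v → (v ∈ P u v ↔ G.Adj u v)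
  p1c : ∀ u v : V, u ≠ v → (P u v = ∅ ↔ ¬ G.Adj u v)
  p2 : ∀ u v : V, u ≠ v → P u v ∩ P v u = ∅

/-- Property (R3) (simple T-partition system). -/
def R3 (P : V → V → Set V) : Prop :=
  ∀ u v x y : V, u ∈ P v x → v ∈ P u y → u ≠ x → v ≠ y → x ∈ P u y ∧ y ∈ P v x

/-- Property (R4) (smooth T-partition system). -/
def R4 (P : V → V → Set V) : Prop :=
  ∀ u v x y z : V, x ∈ P u v → y ∈ P u v → y ∈ P x z → z ∈ P u v

/-- Property (R5) (semi-smooth T-partition system). -/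
def R5 (P : V → V → Set V) : Prop :=
  ∀ u v x y z w : V, x ∈ P u v → y ∈ P u v → y ∈ P x z ∩ P z w →
    z ∈ P u v ∨ w ∈ P u v

namespace IsTravelGroupoid

variable {op : V → V → V}

theorem op_op_self (h : IsTravelGroupoid op) (u v : V) : op u (op u v) = op u v := by
  have h1 := h.1 (op u v) u
  rwa [h.1 u v] at h1

theorem op_self (h : IsTravelGroupoid op) (u : V) : op u u = u :=
  h.2 (op u u) u (by rw [h.1 u u])

theorem op_eq_left (h : IsTravelGroupoid op) {u v : V} : op u v = u ↔ u = v := by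
  refine ⟨fun e => h.2 u v (by rw [e, e]), ?_⟩
  rintro rfl
  exact h.op_self u

theorem isTPartitionSystem_rts (h : IsTravelGroupoid op) {G : SimpleGraph V}
    (hG : IsOnGraph op G) : IsTPartitionSystem G (rts op) where
  cover u a := by
    refine ⟨op u a, ?_, rfl⟩
    by_cases e : op u a = u
    · exact Or.inl e
    · exact Or.inr ((hG _ _).2 ⟨Ne.symm e, h.op_op_self u a⟩)
  pairwise_disjoint u v _ w _ hvw :=
    Set.eq_empty_of_forall_notMem fun _ ha => hvw (ha.1.symm.trans ha.2)
  p1a u := by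
    ext w
    exact h.op_eq_left.trans eq_comm
  p1b u v huv := ((hG u v).trans (and_iff_right huv)).symm
  p1c u v huv := by
    rw [hG u v, and_iff_right huv]
    refine ⟨fun he hv => Set.notMem_empty v (he ▸ hv : v ∈ (∅ : Set V)), fun hv => ?_⟩
    refine Set.eq_empty_of_forall_notMem fun w hw => hv ?_
    have hw : op u w = v := hw
    rw [← hw, h.op_op_self]
  p2 u v huv := by
    refine Set.eq_empty_of_forall_notMem fun w hw => huv ?_
    have h1 : op u w = v := hw.1
    have h2 : op v w = u := hw.2
    obtain rfl : u = w := h.2 u w (by rw [h1, h2])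
    rw [← h1, h.op_self]

end IsTravelGroupoid

theorem rts_injective : Function.Injective (rts : (V → V → V) → V → V → Set V) := by
  intro op op' h
  funext u w
  have hw : w ∈ rts op' u (op u w) := h ▸ (rfl : op u w = op u w)
  exact hw.symm

theorem T4.r4_rts {op : V → V → V} (h : T4 op) : R4 (rts op) := by
  rintro u _ x y _ rfl hy rfl
  exact h u x y hy.symm

theorem R4.t4_of_rts {op : V → V → V} (h : R4 (rts op)) : T4 op :=
  fun u v w e => h u _ v w _ rfl e.symm rfl

namespace IsTPartitionSystem

variable {G : SimpleGraph V} {P : V → V → Set V}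

theorem mem_closedNbhd (h : IsTPartitionSystem G P) {u v a : V} (ha : a ∈ P u v) :
    v ∈ closedNbhd G u := by
  by_cases e : v = u
  · exact Or.inl e
  · refine Or.inr (by_contra fun hn => ?_)
    rw [(h.p1c u v (Ne.symm e)).2 hn] at ha
    exact ha

theorem eq_of_mem (h : IsTPartitionSystem G P) {u v w a : V} (hv : a ∈ P u v)
    (hw : a ∈ P u w) : v = w := by
  by_contra hne
  exact Set.notMem_empty a
    (h.pairwise_disjoint u v (h.mem_closedNbhd hv) w (h.mem_closedNbhd hw) hne ▸ ⟨hv, hw⟩)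

theorem exists_rts_eq (h : IsTPartitionSystem G P) : ∃ op : V → V → V, rts op = P := by
  choose op _ hop using h.cover
  refine ⟨op, ?_⟩
  funext u v
  ext a
  refine ⟨?_, fun ha => h.eq_of_mem (hop u a) ha⟩
  rintro rfl
  exact hop u a

variable {op : V → V → V}

theorem isOnGraph (h : IsTPartitionSystem G (rts op)) : IsOnGraph op G := by
  intro u v
  constructor
  · intro hadj
    exact ⟨hadj.ne, (h.p1b u v hadj.ne).2 hadj⟩
  · rintro ⟨hne, hv⟩
    exact (h.p1b u v hne).1 hv

theorem op_eq_left (h : IsTPartitionSystem G (rts op)) {u v : V} : op u v = u ↔ v = u :=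
  Set.ext_iff.1 (h.p1a u) v

theorem isTravelGroupoid (h : IsTPartitionSystem G (rts op)) : IsTravelGroupoid op := by
  constructor
  · intro u v
    rcases h.mem_closedNbhd (rfl : v ∈ rts op u (op u v)) with e | hadj
    · rw [e]
      exact h.op_eq_left.2 rfl
    · exact ((h.isOnGraph _ _).1 (G.adj_symm hadj)).2
  · intro u v e
    by_cases huv : u = op u v
    · exact (h.op_eq_left.1 huv.symm).symm
    · exact (Set.notMem_empty v (h.p2 u (op u v) huv ▸ ⟨rfl, e⟩)).elim

end IsTPartitionSystem

theorem stmt13 [Nonempty V] (G : SimpleGraph V) :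
    Set.BijOn (fun op : V → V → V => rts op)
      {op : V → V → V | (IsTravelGroupoid op ∧ T4 op) ∧ IsOnGraph op G}
      {P : V → V → Set V | IsTPartitionSystem G P ∧ R4 P} := by
  refine ⟨?_, rts_injective.injOn, ?_⟩
  · rintro op ⟨⟨hop, h4⟩, hG⟩
    exact ⟨hop.isTPartitionSystem_rts hG, h4.r4_rts⟩
  · rintro P ⟨hP, h4⟩
    obtain ⟨op, rfl⟩ := hP.exists_rts_eq
    exact ⟨op, ⟨⟨hP.isTravelGroupoid, h4.t4_of_rts⟩, hP.isOnGraph⟩, rfl⟩
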